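/- Let E, F be finite-dimensional real inner product spaces, A : E → F a continuous linear map, μ > 0, and f : E → ℝ a function such that −f is μ-strongly convex on E. For λ ∈ F define L(x, λ) = f(x) + ⟪λ, A x⟫, let x(λ) ∈ E be a maximizer over E of x ↦ L(x, λ), and define h(λ) := L(x(λ), λ). Suppose x* ∈ E satisfies A x* = 0, and λ* ∈ F satisfies h(λ*) = f(x*) and h(λ*) ≤ h(λ) for all λ. If λ(t) (t ∈ ℕ) is any sequence in F with t · (h(λ(t)) − h(λ*)) → 0 as t → ∞, then √t · ‖x(λ(t)) − x*‖ → 0 as t → ∞; that is, ‖x(λ(t)) − x*‖ = o(1/√t). -/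

import Mathlib

open scoped RealInnerProductSpace

/-- Quadratic growth of a strongly convex function away from a minimizer. -/
lemma StrongConvexOn.half_mul_sq_norm_sub_le_of_isMinOn {E : Type*} [NormedAddCommGroup E]
    [NormedSpace ℝ E] {s : Set E} {m : ℝ} {g : E → ℝ} (hg : StrongConvexOn s m g) {x y : E}
    (hx : x ∈ s) (hmin : IsMinOn g s x) (hy : y ∈ s) :
    m / 2 * ‖x - y‖ ^ 2 ≤ g y - g x := by
  have hlim : Filter.Tendsto (fun a : ℝ => a * (m / 2 * ‖x - y‖ ^ 2)) (nhdsWithin 1 (Set.Iio 1))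
      (nhds (1 * (m / 2 * ‖x - y‖ ^ 2))) :=
    (Filter.tendsto_id.mul_const _).mono_left nhdsWithin_le_nhds
  rw [one_mul] at hlim
  refine le_of_tendsto hlim ?_
  filter_upwards [Ioo_mem_nhdsLT (zero_lt_one' ℝ)] with a ha
  have hb : 0 < 1 - a := sub_pos.2 ha.2
  have hconv := hg.2 hx hy ha.1.le hb.le (add_sub_cancel a 1)
  have hle := isMinOn_iff.1 hmin _ (hg.1 hx hy ha.1.le hb.le (add_sub_cancel a 1))
  simp only [smul_eq_mul] at hconv
  refine le_of_mul_le_mul_left ?_ hb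
  linarith

/-- Corollary 1: if the dual errors satisfy `h(λ(t)) - h(λ*) = o(1/t)`, then the primal
iterates satisfy `‖x(λ(t)) - x*‖ = o(1/√t)`. -/
theorem stmt3
    {E F : Type*} [NormedAddCommGroup E] [InnerProductSpace ℝ E] [FiniteDimensional ℝ E]
    [NormedAddCommGroup F] [InnerProductSpace ℝ F] [FiniteDimensional ℝ F]
    (A : E →L[ℝ] F) (μ : ℝ) (hμ : 0 < μ)
    (f : E → ℝ) (hf : StrongConvexOn Set.univ μ (-f))
    (x : F → E)
    (hmax : ∀ (lam : F) (y : E), f y + ⟪lam, A y⟫ ≤ f (x lam) + ⟪lam, A (x lam)⟫)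
    (h : F → ℝ) (hdef : ∀ lam : F, h lam = f (x lam) + ⟪lam, A (x lam)⟫)
    (xstar : E) (hfeas : A xstar = 0)
    (lstar : F) (hgap : h lstar = f xstar) (hdualmin : ∀ lam : F, h lstar ≤ h lam)
    (lam : ℕ → F)
    (hrate : Filter.Tendsto (fun t : ℕ => (t : ℝ) * (h (lam t) - h lstar))
      Filter.atTop (nhds 0)) :
    Filter.Tendsto (fun t : ℕ => Real.sqrt t * ‖x (lam t) - xstar‖)
      Filter.atTop (nhds 0) := by
  have hbound (l : F) : μ / 2 * ‖x l - xstar‖ ^ 2 ≤ h l - h lstar := by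
    have hlin : ConvexOn ℝ Set.univ (fun y => -⟪l, A y⟫) :=
      (-((innerSL ℝ l).comp A)).toLinearMap.convexOn convex_univ
    have hL : StrongConvexOn Set.univ μ (-f + fun y => -⟪l, A y⟫) := by
      simpa [StrongConvexOn] using UniformConvexOn.add hf (uniformConvexOn_zero.2 hlin)
    have hmin : IsMinOn (-f + fun y => -⟪l, A y⟫) Set.univ (x l) :=
      isMinOn_iff.2 fun y _ => by
        simp only [Pi.add_apply, Pi.neg_apply]
        linarith [hmax l y]
    have hgrowth := hL.half_mul_sq_norm_sub_le_of_isMinOn (Set.mem_univ _) hmin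
      (Set.mem_univ xstar)
    simp only [Pi.add_apply, Pi.neg_apply, hfeas, inner_zero_right] at hgrowth
    linarith [hdef l]
  have hsq : Filter.Tendsto (fun t : ℕ => (t : ℝ) * ‖x (lam t) - xstar‖ ^ 2)
      Filter.atTop (nhds 0) := by
    refine squeeze_zero (fun t => by positivity) (fun t => ?_)
      (by simpa using hrate.const_mul (2 / μ))
    calc (t : ℝ) * ‖x (lam t) - xstar‖ ^ 2
        = 2 / μ * (t * (μ / 2 * ‖x (lam t) - xstar‖ ^ 2)) := by field_simp
      _ ≤ 2 / μ * (t * (h (lam t) - h lstar)) := by gcongr; exact hbound _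
  simpa [Real.sqrt_mul, Real.sqrt_sq] using hsq.sqrt
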